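/- arXiv:1312.5881 — 3 statements merged into one kernel-verified Lean document; each statement's English description precedes it below -/
import Mathlib

section
/- For every integer n ≥ 1, e^n · n! / (n^n · √(2πn) · exp(ψ'(n+1/2)/12)) < exp(1/(240n^3)), where ψ' is the trigamma function. -/
open Real Filter Topology

noncomputable def trigamma (x : ℝ) : ℝ :=
  iteratedDeriv 2 (fun y => Real.log (Real.Gamma y)) x

lemma lgam_contDiffAt {x : ℝ} (hx : 0 < x) :
    ContDiffAt ℝ 2 (fun y => Real.log (Real.Gamma y)) x := by
  have h1 : ContDiffAt ℂ 2 Complex.Gamma (x : ℂ) := by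
    have : AnalyticAt ℂ Complex.Gamma (x : ℂ) := by
      have hopen : IsOpen {z : ℂ | 0 < z.re} := isOpen_lt continuous_const Complex.continuous_re
      have hd : DifferentiableOn ℂ Complex.Gamma {z : ℂ | 0 < z.re} := by
        intro z hz
        refine (Complex.differentiableAt_Gamma z ?_).differentiableWithinAt
        intro m hm
        have hz' : 0 < z.re := hz
        rw [hm] at hz'
        simp at hz'
        have : (0 : ℝ) ≤ m := m.cast_nonneg
        linarith
      exact hd.analyticAt (hopen.mem_nhds (by simpa using hx))
    exact this.contDiffAt
  have h2 : ContDiffAt ℝ 2 Real.Gamma x := h1.real_of_complex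
  exact h2.log (Real.Gamma_pos_of_pos hx).ne'

lemma trigamma_eq (x : ℝ) :
    trigamma x = deriv (deriv (fun y => Real.log (Real.Gamma y))) x := by
  unfold trigamma
  rw [iteratedDeriv_succ, iteratedDeriv_one]

lemma lgam_diff {x : ℝ} (hx : 0 < x) :
    DifferentiableAt ℝ (fun y => Real.log (Real.Gamma y)) x :=
  (lgam_contDiffAt hx).differentiableAt (by norm_num)

lemma lgam_diff2 {x : ℝ} (hx : 0 < x) :
    DifferentiableAt ℝ (deriv (fun y => Real.log (Real.Gamma y))) x := by
  have h := (lgam_contDiffAt hx).fderiv_right (m := 1) (by norm_num)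
  exact (h.differentiableAt (by norm_num)).clm_apply (differentiableAt_const (1 : ℝ))

lemma trigamma_nonneg {x : ℝ} (hx : 0 < x) : 0 ≤ trigamma x := by
  rw [trigamma_eq]
  have hm : MonotoneOn (deriv (fun y => Real.log (Real.Gamma y))) (Set.Ioi 0) :=
    Real.convexOn_log_Gamma.monotoneOn_deriv (fun y hy => lgam_diff hy)
  have := hm.derivWithin_nonneg (x := x)
  rwa [derivWithin_of_isOpen isOpen_Ioi hx] at this

lemma trigamma_add_one {x : ℝ} (hx : 0 < x) :
    trigamma (x + 1) = trigamma x - 1 / x ^ 2 := by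
  rw [trigamma_eq, trigamma_eq]
  set L : ℝ → ℝ := fun y => Real.log (Real.Gamma y) with hL
  have e1 : ∀ y : ℝ, 0 < y → deriv L (y + 1) = deriv L y + y⁻¹ := by
    intro y hy
    rw [← deriv_comp_add_const L 1 y]
    have : (fun z => L (z + 1)) =ᶠ[𝓝 y] fun z => L z + Real.log z := by
      filter_upwards [isOpen_Ioi.mem_nhds hy] with z hz
      have hz' : (0 : ℝ) < z := hz
      simp only [hL]
      rw [Real.Gamma_add_one hz'.ne', Real.log_mul hz'.ne' (Real.Gamma_pos_of_pos hz').ne']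
      ring
    rw [this.deriv_eq]
    exact ((lgam_diff hy).hasDerivAt.add (Real.hasDerivAt_log hy.ne')).deriv
  rw [← deriv_comp_add_const (deriv L) 1 x]
  have : (fun z => deriv L (z + 1)) =ᶠ[𝓝 x] fun z => deriv L z + z⁻¹ := by
    filter_upwards [isOpen_Ioi.mem_nhds hx] with z hz
    exact e1 z hz
  rw [this.deriv_eq]
  refine ((lgam_diff2 hx).hasDerivAt.add (hasDerivAt_inv hx.ne')).deriv.trans ?_
  rw [one_div]; ring

lemma stirling_sd_bound (m : ℕ) :
    log (Stirling.stirlingSeq (m + 1)) - log (Stirling.stirlingSeq (m + 2)) ≤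
      1 / (3 * (2 * ((m : ℝ) + 1) + 1) ^ 2) +
        1 / (20 * ((m : ℝ) + 1) * ((m : ℝ) + 2) * (2 * ((m : ℝ) + 1) + 1) ^ 2) := by
  have h := Stirling.log_stirlingSeq_sdiff_hasSum m
  have hm : (0 : ℝ) ≤ m := m.cast_nonneg
  set y : ℝ := (1 / (2 * ((m + 1 : ℕ) : ℝ) + 1)) ^ 2 with hy
  have hyv : y = 1 / (2 * ((m : ℝ) + 1) + 1) ^ 2 := by
    rw [hy]; push_cast; rw [div_pow, one_pow]
  have hy0 : 0 < y := by rw [hyv]; positivity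
  have hy1 : y < 1 := by
    rw [hyv, div_lt_one (by positivity)]; nlinarith
  have h' := (hasSum_nat_add_iff' 1).mpr h
  have hg := (hasSum_geometric_of_lt_one hy0.le hy1).mul_left (y ^ 2 / 5)
  have hle := hasSum_le (fun k => ?_) h' hg
  · simp only [Finset.sum_range_one] at hle
    have e2 : y ^ 2 / 5 * (1 - y)⁻¹ =
        1 / (20 * ((m : ℝ) + 1) * ((m : ℝ) + 2) * (2 * ((m : ℝ) + 1) + 1) ^ 2) := by
      have : 1 - y = 4 * ((m : ℝ) + 1) * ((m : ℝ) + 2) / (2 * ((m : ℝ) + 1) + 1) ^ 2 := by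
        rw [hyv]; field_simp; ring
      rw [this, hyv]; field_simp; ring
    have e3 : 1 / (3 * (2 * ((m : ℝ) + 1) + 1) ^ 2) = y / 3 := by
      rw [hyv]; field_simp
    rw [e2] at hle
    rw [e3]
    norm_num at hle
    norm_num
    linarith
  · have hk : (0 : ℝ) ≤ k := k.cast_nonneg
    have : (1 : ℝ) / (2 * ((k + 1 + 1 : ℕ) : ℝ) + 1) ≤ 1 / 5 := by
      push_cast
      apply one_div_le_one_div_of_le <;> linarith
    calc _ ≤ 1 / 5 * y ^ (k + 1 + 1) := by gcongr
      _ = _ := by ring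

noncomputable def fseq (m : ℕ) : ℝ :=
  log (Stirling.stirlingSeq (m + 1)) - log √π - trigamma ((m : ℝ) + 1 + 1 / 2) / 12
    - 1 / (240 * ((m : ℝ) + 1) ^ 3)

lemma fseq_lt (m : ℕ) : fseq m < fseq (m + 1) := by
  unfold fseq
  have h := stirling_sd_bound m
  have hm : (0 : ℝ) ≤ m := m.cast_nonneg
  have ht := trigamma_add_one (x := (m : ℝ) + 1 + 1 / 2) (by positivity)
  push_cast
  rw [show (m : ℝ) + 1 + 1 + 1 / 2 = (m : ℝ) + 1 + 1 / 2 + 1 by ring, ht]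
  rw [show m + 1 + 1 = m + 2 from rfl]
  have e : 1 / (3 * (2 * ((m : ℝ) + 1) + 1) ^ 2) = 1 / ((m : ℝ) + 1 + 1 / 2) ^ 2 / 12 := by
    field_simp; ring
  have e2 : 1 / (20 * ((m : ℝ) + 1) * ((m : ℝ) + 2) * (2 * ((m : ℝ) + 1) + 1) ^ 2) <
      1 / (240 * ((m : ℝ) + 1) ^ 3) - 1 / (240 * ((m : ℝ) + 1 + 1) ^ 3) := by
    rw [← sub_pos]
    have : 1 / (240 * ((m : ℝ) + 1) ^ 3) - 1 / (240 * ((m : ℝ) + 1 + 1) ^ 3) -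
      1 / (20 * ((m : ℝ) + 1) * ((m : ℝ) + 2) * (2 * ((m : ℝ) + 1) + 1) ^ 2) =
      (7 * (((m : ℝ) + 1) * ((m : ℝ) + 2)) + 1) /
        (240 * ((m : ℝ) + 1) ^ 3 * ((m : ℝ) + 2) ^ 3 * (2 * ((m : ℝ) + 1) + 1) ^ 2) := by
      rw [show (m : ℝ) + 1 + 1 = m + 2 by ring]
      field_simp; ring
    rw [this]; positivity
  linarith

lemma fseq_neg (m : ℕ) : fseq m < 0 := by
  have hmono : Monotone fseq := monotone_nat_of_le_succ fun k => (fseq_lt k).le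
  have hlim : Tendsto (fun k : ℕ => log (Stirling.stirlingSeq (k + 1)) - log √π) atTop (𝓝 0) := by
    have h := (Stirling.tendsto_stirlingSeq_sqrt_pi.comp (tendsto_add_atTop_nat 1)).log
      (by positivity)
    simpa using h.sub_const (log √π)
  refine (fseq_lt m).trans_le (ge_of_tendsto hlim ?_)
  filter_upwards [eventually_ge_atTop (m + 1)] with k hk
  refine (hmono hk).trans ?_
  unfold fseq
  have h1 := trigamma_nonneg (x := (k : ℝ) + 1 + 1 / 2) (by positivity)
  have h2 : 0 ≤ 1 / (240 * ((k : ℝ) + 1) ^ 3) := by positivity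
  linarith

theorem stmt0 (n : ℕ) (hn : 1 ≤ n) :
    Real.exp n * (n.factorial : ℝ) /
      ((n : ℝ) ^ n * Real.sqrt (2 * Real.pi * n) * Real.exp (trigamma (n + 1/2) / 12)) <
    Real.exp (1 / (240 * (n : ℝ) ^ 3)) := by
  obtain ⟨m, rfl⟩ : ∃ m, n = m + 1 := ⟨n - 1, by omega⟩
  have h := fseq_neg m
  unfold fseq at h
  have hs := Stirling.stirlingSeq'_pos m
  have hpi : 0 < √π := by positivity
  have key : Real.exp ((m + 1 : ℕ) : ℝ) * ((m + 1).factorial : ℝ) /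
      (((m + 1 : ℕ) : ℝ) ^ (m + 1) * √(2 * π * ((m + 1 : ℕ) : ℝ)) *
        Real.exp (trigamma (((m + 1 : ℕ) : ℝ) + 1/2) / 12)) =
      Real.exp (log (Stirling.stirlingSeq (m + 1)) - log √π
        - trigamma (((m + 1 : ℕ) : ℝ) + 1 / 2) / 12) := by
    rw [Real.exp_sub, Real.exp_sub, Real.exp_log hs, Real.exp_log hpi, Stirling.stirlingSeq]
    rw [show 2 * π * ((m + 1 : ℕ) : ℝ) = (2 * ((m + 1 : ℕ) : ℝ)) * π by ring,
      Real.sqrt_mul (by positivity), div_pow, ← Real.exp_nat_mul, mul_one]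
    have : 0 < √(2 * ((m + 1 : ℕ) : ℝ)) := by positivity
    field_simp
  rw [key, Real.exp_lt_exp]
  push_cast
  linarith
end

section
/- As x → ∞, ln Γ(x+1) − (x+1/2)·ln x + x − ln√(2π) − ψ'(x+1/2)/12 = 1/(240x^3) − 11/(6720x^5) + O(1/x^7). -/
open Real Filter Topology Asymptotics

theorem aux_summ : Summable (fun n : ℕ => 1 / ((n : ℝ) + 1) ^ 2) := by
  have := (summable_nat_add_iff (f := fun n : ℕ => 1 / (n : ℝ) ^ 2) 1).2
    (Real.summable_one_div_nat_pow.2 (by norm_num))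
  simpa using this

theorem aux_log_bounds (n : ℕ) :
    1 / ((n : ℝ) + 2) ≤ Real.log (n + 2) - Real.log (n + 1) ∧
    Real.log (n + 2) - Real.log (n + 1) ≤ 1 / ((n : ℝ) + 1) := by
  have h1 : (0 : ℝ) < (n : ℝ) + 1 := by positivity
  have h2 : (0 : ℝ) < (n : ℝ) + 2 := by positivity
  constructor
  · have := Real.log_le_sub_one_of_pos (div_pos h1 h2)
    rw [Real.log_div h1.ne' h2.ne'] at this
    have e : ((n : ℝ) + 1) / (n + 2) - 1 = - (1 / ((n : ℝ) + 2)) := by field_simp; ring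
    linarith
  · have := Real.log_le_sub_one_of_pos (div_pos h2 h1)
    rw [Real.log_div h2.ne' h1.ne'] at this
    have e : ((n : ℝ) + 2) / (n + 1) - 1 = (1 / ((n : ℝ) + 1)) := by field_simp; ring
    linarith

theorem aux_b_bound (R : ℝ) (n : ℕ) (y : ℝ) (hy : 0 < y) (hR : y < R) :
    ‖(Real.log (n + 2) - Real.log (n + 1)) - 1 / (y + n + 1)‖
      ≤ (R + 1) * (1 / ((n : ℝ) + 1) ^ 2) := by
  obtain ⟨l, u⟩ := aux_log_bounds n
  have h1 : (0 : ℝ) < (n : ℝ) + 1 := by positivity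
  have k1 : 1 / (y + n + 1) ≤ 1 / ((n : ℝ) + 1) := by
    apply one_div_le_one_div_of_le h1; linarith
  have k2 : 1 / (R + 1 + (n + 1)) ≤ 1 / (y + n + 1) := by
    apply one_div_le_one_div_of_le <;> linarith
  have k3 : 1 / (R + 1 + (n + 1)) ≤ 1 / ((n : ℝ) + 2) := by
    apply one_div_le_one_div_of_le <;> linarith
  have k4 : 1 / ((n : ℝ) + 1) - 1 / (R + 1 + (n + 1)) ≤ (R + 1) * (1 / ((n : ℝ) + 1) ^ 2) := by
    have : 1 / ((n : ℝ) + 1) - 1 / (R + 1 + (n + 1)) = (R + 1) * (1 / (((n : ℝ) + 1) * (R + 1 + (n + 1)))) := by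
      have : R + 1 + ((n : ℝ) + 1) ≠ 0 := by linarith
      field_simp; ring
    rw [this]
    apply mul_le_mul_of_nonneg_left _ (by linarith)
    apply one_div_le_one_div_of_le (by positivity)
    nlinarith
  rw [Real.norm_eq_abs, abs_le]
  constructor <;> linarith

theorem aux_a_deriv (n : ℕ) (y : ℝ) (hy : 0 < y) :
    HasDerivAt (fun x : ℝ => x * (Real.log (n + 2) - Real.log (n + 1))
      - (Real.log (x + n + 1) - Real.log (n + 1)))
      ((Real.log (n + 2) - Real.log (n + 1)) - 1 / (y + n + 1)) y := by
  have h : HasDerivAt (fun x : ℝ => x + n + 1) 1 y := ((hasDerivAt_id y).add_const _).add_const _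
  have h2 := (h.log (by positivity)).sub_const (Real.log ((n:ℝ) + 1))
  have h3 := (hasDerivAt_id y).mul_const (Real.log ((n:ℝ) + 2) - Real.log ((n:ℝ) + 1))
  refine HasDerivAt.congr_deriv (h3.sub h2) ?_
  simp

theorem aux_b_deriv (n : ℕ) (y : ℝ) (hy : 0 < y) :
    HasDerivAt (fun x : ℝ => (Real.log (n + 2) - Real.log (n + 1)) - 1 / (x + n + 1))
      (1 / (y + n + 1) ^ 2) y := by
  have h : HasDerivAt (fun x : ℝ => x + n + 1) 1 y := ((hasDerivAt_id y).add_const _).add_const _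
  have h2 := (h.inv (by positivity)).const_sub (Real.log ((n:ℝ) + 2) - Real.log ((n:ℝ) + 1))
  refine HasDerivAt.congr_of_eventuallyEq (h2.congr_deriv ?_) ?_
  · ring
  · exact Eventually.of_forall (fun x => by simp)

theorem aux_a_summ (x : ℝ) (hx : 0 < x) :
    Summable (fun n : ℕ => x * (Real.log (n + 2) - Real.log (n + 1))
      - (Real.log (x + n + 1) - Real.log (n + 1))) := by
  refine summable_of_summable_hasDerivAt_of_isPreconnected
    (t := Set.Ioo 0 (x + 2)) (y₀ := (1 : ℝ)) (y := x) (aux_summ.mul_left (x + 2 + 1)) isOpen_Ioo isPreconnected_Ioo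
    (g := fun (n : ℕ) (x : ℝ) => x * (Real.log (n + 2) - Real.log (n + 1))
      - (Real.log (x + n + 1) - Real.log (n + 1)))
    (fun n y hy => aux_a_deriv n y hy.1) (fun n y hy => aux_b_bound _ n y hy.1 hy.2)
    ⟨by norm_num, by linarith⟩ ?_ ⟨hx, by linarith⟩
  refine (summable_zero : Summable (fun _ : ℕ => (0 : ℝ))).congr (fun n => ?_)
  have : (1 : ℝ) + n + 1 = n + 2 := by ring
  rw [this]; ring

theorem aux_partial (x : ℝ) (N : ℕ) :
    ∑ n ∈ Finset.range N, (x * (Real.log ((n : ℝ) + 2) - Real.log (n + 1))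
      - (Real.log (x + n + 1) - Real.log (n + 1))) - Real.log x
      = Real.BohrMollerup.logGammaSeq x N + x * (Real.log (N + 1) - Real.log N) := by
  unfold Real.BohrMollerup.logGammaSeq
  rw [Finset.sum_range_succ']
  have h : ∀ M : ℕ, ∑ n ∈ Finset.range M, (x * (Real.log ((n : ℝ) + 2) - Real.log (n + 1))
      - (Real.log (x + n + 1) - Real.log (n + 1))) = x * Real.log (M + 1) +
      Real.log (M.factorial) - ∑ n ∈ Finset.range M, Real.log (x + n + 1) := by
    intro M
    induction M with
    | zero => simp
    | succ k ih =>
      rw [Finset.sum_range_succ, ih, Finset.sum_range_succ, Nat.factorial_succ]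
      push_cast
      rw [Real.log_mul (by positivity) (by positivity)]
      have : (k : ℝ) + 1 + 1 = k + 2 := by ring
      rw [this]; ring
  rw [h]
  push_cast
  simp only [add_assoc, add_zero]
  ring

theorem aux_logGamma (x : ℝ) (hx : 0 < x) :
    Real.log (Real.Gamma x) = (∑' n : ℕ, (x * (Real.log ((n : ℝ) + 2) - Real.log (n + 1))
      - (Real.log (x + n + 1) - Real.log (n + 1)))) - Real.log x := by
  have h1 := ((aux_a_summ x hx).hasSum.tendsto_sum_nat).sub_const (Real.log x)
  simp_rw [aux_partial] at h1
  have h2 := (Real.BohrMollerup.tendsto_log_gamma hx).add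
    (Real.tendsto_log_nat_add_one_sub_log.const_mul x)
  rw [mul_zero, add_zero] at h2
  exact tendsto_nhds_unique h2 h1

theorem aux_deriv1 (x : ℝ) (hx : 0 < x) :
    HasDerivAt (fun y => Real.log (Real.Gamma y))
      ((∑' n : ℕ, ((Real.log ((n : ℝ) + 2) - Real.log (n + 1)) - 1 / (x + n + 1))) - 1 / x) x := by
  have h1 := hasDerivAt_tsum_of_isPreconnected
    (t := Set.Ioo 0 (x + 2)) (y₀ := x) (y := x) (aux_summ.mul_left (x + 2 + 1)) isOpen_Ioo isPreconnected_Ioo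
    (g := fun (n : ℕ) (x : ℝ) => x * (Real.log (n + 2) - Real.log (n + 1))
      - (Real.log (x + n + 1) - Real.log (n + 1)))
    (fun n y hy => aux_a_deriv n y hy.1) (fun n y hy => aux_b_bound _ n y hy.1 hy.2)
    ⟨hx, by linarith⟩ (aux_a_summ x hx) ⟨hx, by linarith⟩
  have h2 := h1.sub (Real.hasDerivAt_log hx.ne')
  rw [← one_div] at h2
  refine h2.congr_of_eventuallyEq ?_
  filter_upwards [lt_mem_nhds hx] with y hy
  exact aux_logGamma y hy

theorem aux_trigamma (x : ℝ) (hx : 0 < x) :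
    Summable (fun n : ℕ => 1 / (x + n) ^ 2) ∧ trigamma x = ∑' n : ℕ, 1 / (x + n) ^ 2 := by
  have hb : ∀ n : ℕ, ∀ y : ℝ, 0 < y → ‖1 / (y + n + 1) ^ 2‖ ≤ 1 / ((n : ℝ) + 1) ^ 2 := by
    intro n y hy
    rw [Real.norm_of_nonneg (by positivity)]
    apply one_div_le_one_div_of_le (by positivity)
    gcongr; linarith
  have h1 := hasDerivAt_tsum_of_isPreconnected
    (t := Set.Ioi (0 : ℝ)) (y₀ := x) (y := x) aux_summ isOpen_Ioi isPreconnected_Ioi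
    (g := fun (n : ℕ) (x : ℝ) => (Real.log ((n : ℝ) + 2) - Real.log (n + 1)) - 1 / (x + n + 1))
    (fun n y hy => aux_b_deriv n y hy) (fun n y hy => hb n y hy)
    hx (Summable.of_norm_bounded (aux_summ.mul_left (x + 1 + 1))
      (fun n => aux_b_bound (x + 1) n x hx (by linarith))) hx
  have h2 := h1.sub (hasDerivAt_inv hx.ne')
  have hs : Summable (fun n : ℕ => 1 / (x + n + 1) ^ 2) :=
    Summable.of_norm_bounded aux_summ (fun n => hb n x hx)
  have hs' : Summable (fun n : ℕ => 1 / (x + n) ^ 2) := by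
    rw [← summable_nat_add_iff 1]
    refine hs.congr (fun n => ?_)
    push_cast; ring_nf
  refine ⟨hs', ?_⟩
  rw [hs'.tsum_eq_zero_add]
  unfold trigamma
  rw [iteratedDeriv_succ, iteratedDeriv_one]
  have : deriv (fun y => Real.log (Real.Gamma y)) =ᶠ[𝓝 x] fun z =>
      (∑' n : ℕ, ((Real.log ((n : ℝ) + 2) - Real.log (n + 1)) - 1 / (z + n + 1))) - z⁻¹ := by
    filter_upwards [lt_mem_nhds hx] with y hy
    rw [(aux_deriv1 y hy).deriv, one_div y]
  rw [this.deriv_eq]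
  refine h2.deriv.trans ?_
  rw [sub_neg_eq_add, add_comm]
  congr 1
  · simp
  · congr 1; ext n; push_cast; ring_nf

theorem aux_trigamma_step (x : ℝ) (hx : 0 < x) : trigamma x = 1 / x ^ 2 + trigamma (x + 1) := by
  obtain ⟨s, e⟩ := aux_trigamma x hx
  rw [e, (aux_trigamma (x + 1) (by linarith)).2, s.tsum_eq_zero_add]
  congr 1
  · simp
  · congr 1; ext n; push_cast; ring_nf

theorem aux_trigamma_lim (x : ℝ) (hx : 0 < x) :
    Tendsto (fun N : ℕ => trigamma (x + N)) atTop (𝓝 0) := by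
  have := tendsto_sum_nat_add (fun n : ℕ => 1 / (x + n) ^ 2)
  refine this.congr (fun N => ?_)
  rw [(aux_trigamma (x + N) (by positivity)).2]
  congr 1; ext n; push_cast; ring_nf

noncomputable def auxF (x : ℝ) : ℝ :=
  (Real.log (Real.Gamma (x + 1)) - (x + 1/2) * Real.log x + x
            - Real.log (Real.sqrt (2 * Real.pi)) - trigamma (x + 1/2) / 12)
          - (1 / (240 * x ^ 3) - 11 / (6720 * x ^ 5))

theorem aux_rat (t : ℝ) (h0 : 0 < t) (h1 : t ≤ 1 / 3) :
    |t ^ 4 / 5 + t ^ 6 / 7 - 1 / 240 * (8 * t ^ 3 / (1 - t) ^ 3 - 8 * t ^ 3 / (1 + t) ^ 3)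
      + 11 / 6720 * (32 * t ^ 5 / (1 - t) ^ 5 - 32 * t ^ 5 / (1 + t) ^ 5)| ≤ 10 * t ^ 8 := by
  have e : t ^ 4 / 5 + t ^ 6 / 7 - 1 / 240 * (8 * t ^ 3 / (1 - t) ^ 3 - 8 * t ^ 3 / (1 + t) ^ 3)
      + 11 / 6720 * (32 * t ^ 5 / (1 - t) ^ 5 - 32 * t ^ 5 / (1 + t) ^ 5)
      = t ^ 8 * ((238 - 56 * t ^ 2 - 45 * t ^ 4 + 54 * t ^ 6 - 15 * t ^ 8)
        / (105 * (1 - t ^ 2) ^ 5)) := by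
    have a1 : 1 - t ≠ 0 := by linarith
    have a2 : 1 + t ≠ 0 := by linarith
    have a3 : 1 - t ^ 2 = (1 - t) * (1 + t) := by ring
    rw [a3]
    field_simp
    ring
  have hs : t ^ 2 ≤ 1 / 9 := by nlinarith
  have hd : (8 / 9 : ℝ) ^ 5 ≤ (1 - t ^ 2) ^ 5 := by
    apply pow_le_pow_left₀ (by norm_num); linarith
  have p4 : t ^ 4 ≤ 1 := pow_le_one₀ h0.le (by linarith)
  have p6 : t ^ 6 ≤ 1 := pow_le_one₀ h0.le (by linarith)
  have p8 : t ^ 8 ≤ 1 := pow_le_one₀ h0.le (by linarith)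
  have q2 : 0 ≤ t ^ 2 := by positivity
  have q4 : 0 ≤ t ^ 4 := by positivity
  have q6 : 0 ≤ t ^ 6 := by positivity
  have q8 : 0 ≤ t ^ 8 := by positivity
  have hd' : 0 < (1 - t ^ 2) ^ 5 := lt_of_lt_of_le (by norm_num) hd
  rw [e, abs_mul, abs_of_nonneg q8, mul_comm]
  apply mul_le_mul_of_nonneg_right _ q8
  rw [abs_of_nonneg (div_nonneg (by linarith) (by positivity)), div_le_iff₀ (by positivity)]
  norm_num at hd
  linarith

theorem aux_log_exp (t : ℝ) (h0 : 0 < t) (h1 : t ≤ 1 / 3) :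
    |1 / (2 * t) * Real.log ((1 + t) / (1 - t)) - 1 - t ^ 2 / 3 - t ^ 4 / 5 - t ^ 6 / 7|
      ≤ 2 * t ^ 8 := by
  have l := Real.sum_range_le_log_div h0.le (by linarith : t < 1) 4
  have u := Real.log_div_le_sum_range_add h0.le (by linarith : t < 1) 4
  simp only [Finset.sum_range_succ, Finset.sum_range_zero] at l u
  norm_num at l u
  have hb : t ^ 9 / (1 - t ^ 2) ≤ 2 * t ^ 9 := by
    have : 0 < t ^ 9 := by positivity
    have h2 : 1 / 2 ≤ 1 - t ^ 2 := by nlinarith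
    rw [div_le_iff₀ (by linarith)]
    have := mul_le_mul_of_nonneg_left h2 this.le
    linarith
  set L := Real.log ((1 + t) / (1 - t))
  have e : 1 / (2 * t) * L - 1 - t ^ 2 / 3 - t ^ 4 / 5 - t ^ 6 / 7
    = (1 / 2 * L - (t + t ^ 3 / 3 + t ^ 5 / 5 + t ^ 7 / 7)) / t := by field_simp; ring
  rw [e, abs_of_nonneg (div_nonneg (by linarith) h0.le), div_le_iff₀ h0]
  have : 2 * t ^ 8 * t = 2 * t ^ 9 := by ring
  linarith

theorem aux_step (x : ℝ) (hx : 1 ≤ x) :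
    |auxF x - auxF (x + 1)| ≤ 12 * (1 / x ^ 7 - 1 / (x + 1) ^ 7) := by
  have hx0 : 0 < x := by linarith
  obtain ⟨t, ht⟩ : ∃ t : ℝ, t = 1 / (2 * x + 1) := ⟨_, rfl⟩
  have h0 : 0 < t := by rw [ht]; positivity
  have h1 : t ≤ 1 / 3 := by
    rw [ht]; apply one_div_le_one_div_of_le <;> linarith
  have hA := aux_log_exp t h0 h1
  have hB := aux_rat t h0 h1
  have ex : (1 + t) / (1 - t) = (x + 1) / x := by
    have : 1 - t ≠ 0 := by linarith
    rw [div_eq_div_iff this hx0.ne', ht]; field_simp; ring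
  have g1 : Real.log (Real.Gamma (x + 1 + 1)) = Real.log (x + 1) + Real.log (Real.Gamma (x + 1)) := by
    rw [Real.Gamma_add_one (by positivity), Real.log_mul (by positivity)
      (Real.Gamma_pos_of_pos (by positivity)).ne']
  have g2 := aux_trigamma_step (x + 1 / 2) (by positivity)
  have g3 : x + 1 / 2 + 1 = x + 1 + 1 / 2 := by ring
  rw [g3] at g2
  have hl : Real.log ((1 + t) / (1 - t)) = Real.log (x + 1) - Real.log x := by
    rw [ex, Real.log_div (by positivity) (by positivity)]
  have c1 : 8 * t ^ 3 / (1 - t) ^ 3 = 1 / x ^ 3 := by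
    have : 1 - t = 2 * x * t := by rw [ht]; field_simp; ring
    rw [this]; field_simp; norm_num
  have c2 : 8 * t ^ 3 / (1 + t) ^ 3 = 1 / (x + 1) ^ 3 := by
    have : 1 + t = 2 * (x + 1) * t := by rw [ht]; field_simp; ring
    rw [this]; field_simp; norm_num
  have c3 : 32 * t ^ 5 / (1 - t) ^ 5 = 1 / x ^ 5 := by
    have : 1 - t = 2 * x * t := by rw [ht]; field_simp; ring
    rw [this]; field_simp; norm_num
  have c4 : 32 * t ^ 5 / (1 + t) ^ 5 = 1 / (x + 1) ^ 5 := by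
    have : 1 + t = 2 * (x + 1) * t := by rw [ht]; field_simp; ring
    rw [this]; field_simp; norm_num
  have c5 : 1 / (2 * t) = x + 1 / 2 := by rw [ht]; field_simp
  have c6 : 1 / (x + 1 / 2) ^ 2 = 4 * t ^ 2 := by rw [← c5]; field_simp; norm_num
  rw [hl, c5] at hA
  rw [c1, c2, c3, c4] at hB
  have d1 : ∀ z : ℝ, 1 / (240 * z ^ 3) = 1 / 240 * (1 / z ^ 3) := fun z => by
    rw [one_div_mul_one_div]
  have d2 : ∀ z : ℝ, 11 / (6720 * z ^ 5) = 11 / 6720 * (1 / z ^ 5) := fun z => by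
    rw [div_mul_div_comm, mul_one]
  have key : auxF x - auxF (x + 1) =
      ((x + 1 / 2) * (Real.log (x + 1) - Real.log x) - 1 - t ^ 2 / 3 - t ^ 4 / 5 - t ^ 6 / 7)
      + (t ^ 4 / 5 + t ^ 6 / 7 - 1 / 240 * (1 / x ^ 3 - 1 / (x + 1) ^ 3)
        + 11 / 6720 * (1 / x ^ 5 - 1 / (x + 1) ^ 5)) := by
    unfold auxF
    rw [g1, g2, c6, d1, d1, d2, d2]
    ring
  have ht8 : t ^ 8 ≤ 1 / x ^ 7 - 1 / (x + 1) ^ 7 := by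
    have s1 : t ^ 8 ≤ 1 / (x + 1) ^ 8 := by
      rw [ht, div_pow, one_pow]
      apply one_div_le_one_div_of_le (by positivity)
      gcongr; linarith
    have s2 : 1 / (x + 1) ^ 8 ≤ 1 / (x ^ 7 * (x + 1)) := by
      apply one_div_le_one_div_of_le (by positivity)
      rw [pow_succ (x + 1) 7]
      gcongr; linarith
    have s3 : 1 / (x + 1) ^ 7 ≤ 1 / (x ^ 6 * (x + 1)) := by
      apply one_div_le_one_div_of_le (by positivity)
      rw [pow_succ (x + 1) 6]
      gcongr; linarith
    have s4 : 1 / x ^ 7 - 1 / (x ^ 6 * (x + 1)) = 1 / (x ^ 7 * (x + 1)) := by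
      field_simp; ring
    linarith
  rw [key]
  refine (abs_add_le _ _).trans ?_
  linarith

theorem aux_iter (x : ℝ) (hx : 1 ≤ x) (N : ℕ) :
    |auxF x| ≤ |auxF (x + N)| + 12 * (1 / x ^ 7 - 1 / (x + N) ^ 7) := by
  induction N with
  | zero => simp
  | succ k ih =>
    have h := aux_step (x + k) (by have : (0 : ℝ) ≤ k := by positivity
                                   linarith)
    have := abs_sub_abs_le_abs_sub (auxF (x + k)) (auxF (x + k + 1))
    push_cast
    rw [← add_assoc]
    linarith

theorem aux_logGamma_add (x : ℝ) (hx : 0 < x) (N : ℕ) :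
    Real.log (Real.Gamma (x + N + 1)) = Real.log (Real.Gamma x)
      + ∑ m ∈ Finset.range (N + 1), Real.log (x + m) := by
  induction N with
  | zero =>
    simp
    rw [Real.Gamma_add_one hx.ne', Real.log_mul hx.ne' (Real.Gamma_pos_of_pos hx).ne']; ring
  | succ k ih =>
    rw [Finset.sum_range_succ, ← add_assoc, ← ih]
    push_cast
    rw [← add_assoc, Real.Gamma_add_one (by positivity), Real.log_mul (by positivity)
      (Real.Gamma_pos_of_pos (by positivity)).ne']
    ring

/-- Comparison of `log (1 + x / N)` with `x / N`. -/
theorem aux_log_mul (x : ℝ) :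
    Tendsto (fun N : ℕ => (N : ℝ) * Real.log (1 + x / N)) atTop (𝓝 x) :=
  (Real.tendsto_mul_log_one_add_div_atTop x).comp tendsto_natCast_atTop_atTop

theorem aux_stirling (x : ℝ) (hx : 0 < x) :
    Tendsto (fun N : ℕ => Real.log (Real.Gamma (x + N + 1)) - (x + N + 1 / 2) * Real.log (x + N)
      + (x + N) - Real.log (Real.sqrt (2 * Real.pi))) atTop (𝓝 0) := by
  have h1 := (Real.BohrMollerup.tendsto_log_gamma hx).const_sub (Real.log (Real.Gamma x))
  have h2 := (Stirling.tendsto_stirlingSeq_sqrt_pi).log (by positivity)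
  have h3 := aux_log_mul x
  have h4 : Tendsto (fun N : ℕ => (x + 1 / 2) * Real.log (1 + x / N)) atTop (𝓝 0) := by
    have a : Tendsto (fun N : ℕ => 1 + x / (N : ℝ)) atTop (𝓝 (1 + 0)) :=
      (tendsto_const_div_atTop_nhds_zero_nat x).const_add 1
    have b := (a.log (by norm_num)).const_mul (x + 1 / 2)
    simpa using b
  have h5 := (((h1.add h2).sub h3).sub h4).add_const
    (x + Real.log 2 / 2 - Real.log (Real.sqrt (2 * Real.pi)))
  have hz : Real.log (Real.Gamma x) - Real.log (Real.Gamma x) + Real.log (Real.sqrt Real.pi) - x - 0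
     + (x + Real.log 2 / 2 - Real.log (Real.sqrt (2 * Real.pi))) = 0 := by
    rw [Real.log_sqrt Real.pi_pos.le, Real.log_sqrt (by positivity),
      Real.log_mul (by norm_num) Real.pi_ne_zero]
    ring
  rw [hz] at h5
  refine h5.congr' ?_
  filter_upwards [eventually_gt_atTop 0] with N hN
  have hN' : (0 : ℝ) < N := by exact_mod_cast hN
  have e1 : 1 + x / (N : ℝ) = (x + N) / N := by field_simp; ring
  rw [aux_logGamma_add x hx, Stirling.log_stirlingSeq_formula, e1,
    Real.log_div (by positivity) hN'.ne', Real.log_div hN'.ne' (Real.exp_pos 1).ne', Real.log_exp,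
    Real.log_mul (by norm_num) hN'.ne']
  unfold Real.BohrMollerup.logGammaSeq
  ring

theorem aux_F_lim (x : ℝ) (hx : 0 < x) :
    Tendsto (fun N : ℕ => auxF (x + N)) atTop (𝓝 0) := by
  have h1 := aux_stirling x hx
  have h2 := (aux_trigamma_lim (x + 1 / 2) (by positivity)).div_const 12
  have hT : Tendsto (fun N : ℕ => x + (N : ℝ)) atTop atTop :=
    tendsto_atTop_add_const_left _ _ tendsto_natCast_atTop_atTop
  have hI := tendsto_inv_atTop_zero.comp hT
  have h3 := ((hI.pow 3).const_mul (1 / 240)).sub ((hI.pow 5).const_mul (11 / 6720))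
  have h := (h1.sub h2).sub h3
  norm_num at h
  refine h.congr (fun N => ?_)
  unfold auxF
  have : x + 1 / 2 + (N : ℝ) = x + N + 1 / 2 := by ring
  norm_num at this ⊢
  rw [this]
  simp only [div_eq_mul_inv, mul_inv]
  ring

theorem stmt13 :
    (fun x : ℝ =>
        (Real.log (Real.Gamma (x + 1)) - (x + 1/2) * Real.log x + x
            - Real.log (Real.sqrt (2 * Real.pi)) - trigamma (x + 1/2) / 12)
          - (1 / (240 * x ^ 3) - 11 / (6720 * x ^ 5)))
      =O[Filter.atTop] (fun x : ℝ => 1 / x ^ 7) := by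
  refine IsBigO.of_bound 12 ?_
  filter_upwards [eventually_ge_atTop 1] with x hx
  have hx0 : 0 < x := by linarith
  change ‖auxF x‖ ≤ _
  rw [Real.norm_eq_abs, Real.norm_of_nonneg (by positivity)]
  have hl := ((aux_F_lim x hx0).abs).add_const (12 * (1 / x ^ 7))
  rw [abs_zero, zero_add] at hl
  refine ge_of_tendsto' hl (fun N => ?_)
  have h := aux_iter x hx N
  have : 0 ≤ 1 / (x + N) ^ 7 := by positivity
  linarith
end

section
/- For all real x > 1/2, Γ(x+1) > (x^x/e^x)·√(2πx)·exp(ψ'(x+1/2)/12). -/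
open Real Filter Topology Asymptotics

noncomputable def sbG (k : ℕ) (x : ℝ) : ℝ :=
  x * (Real.log (k + 2) - Real.log (k + 1)) - (Real.log (x + k + 1) - Real.log (k + 1))

noncomputable def sbG1 (k : ℕ) (x : ℝ) : ℝ :=
  (Real.log (k + 2) - Real.log (k + 1)) - (x + k + 1)⁻¹

noncomputable def sbG2 (k : ℕ) (x : ℝ) : ℝ := ((x + k + 1) ^ 2)⁻¹

lemma sb_summable (c : ℝ) : Summable (fun k : ℕ => c * (((k : ℝ) + 1) ^ 2)⁻¹) := by
  have h := (summable_nat_add_iff 1).2 (Real.summable_nat_pow_inv.2 (one_lt_two))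
  simpa using h.mul_left c

lemma sb_d1 (k : ℕ) (x : ℝ) (hx : 0 < x) : HasDerivAt (sbG k) (sbG1 k x) x := by
  have hp : x + k + 1 ≠ 0 := by positivity
  have h1 : HasDerivAt (fun y : ℝ => y + k + 1) 1 x :=
    ((hasDerivAt_id x).add_const _).add_const _
  have h2 := ((hasDerivAt_id x).mul_const (Real.log (k + 2) - Real.log (k + 1))).sub
    ((h1.log hp).sub_const (Real.log (k + 1)))
  convert! h2 using 1
  simp [sbG1]

lemma sb_d2 (k : ℕ) (x : ℝ) (hx : 0 < x) : HasDerivAt (sbG1 k) (sbG2 k x) x := by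
  have hp : x + k + 1 ≠ 0 := by positivity
  have h1 : HasDerivAt (fun y : ℝ => y + k + 1) 1 x :=
    ((hasDerivAt_id x).add_const _).add_const _
  have h2 := (h1.inv hp).const_sub (Real.log (k + 2) - Real.log (k + 1))
  convert! h2 using 1
  simp [sbG2]
  field_simp

lemma sb_b2 (k : ℕ) (x : ℝ) (hx : 0 < x) : ‖sbG2 k x‖ ≤ 1 * (((k : ℝ) + 1) ^ 2)⁻¹ := by
  unfold sbG2
  rw [Real.norm_of_nonneg (by positivity), one_mul]
  gcongr
  linarith

lemma sb_b1 (R : ℝ) (k : ℕ) (x : ℝ) (hx : 0 < x) (hR : x < R) :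
    ‖sbG1 k x‖ ≤ (R + 1) * (((k : ℝ) + 1) ^ 2)⁻¹ := by
  unfold sbG1
  have hk : (0 : ℝ) < k + 1 := by positivity
  have e : Real.log (k + 2) - Real.log (k + 1) = Real.log ((k + 2) / (k + 1)) := by
    rw [Real.log_div] <;> positivity
  have h1 := Real.log_le_sub_one_of_pos (show (0 : ℝ) < (k + 2) / (k + 1) by positivity)
  have h2 := Real.one_sub_inv_le_log_of_pos (show (0 : ℝ) < (k + 2) / (k + 1) by positivity)
  rw [← e] at h1 h2
  have e1 : ((k : ℝ) + 2) / (k + 1) - 1 = 1 / (k + 1) := by field_simp; ring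
  have e2 : 1 - (((k : ℝ) + 2) / (k + 1))⁻¹ = 1 / (k + 2) := by field_simp; ring
  rw [e1] at h1
  rw [e2] at h2
  have h3 : (x + k + 1)⁻¹ ≤ 1 / ((k : ℝ) + 1) := by
    rw [one_div]; gcongr; linarith
  have h4 : 1 / ((k : ℝ) + 1) - (x + k + 1)⁻¹ ≤ R * (((k : ℝ) + 1) ^ 2)⁻¹ := by
    have : 1 / ((k : ℝ) + 1) - (x + k + 1)⁻¹ = x * (((k : ℝ) + 1) * (x + k + 1))⁻¹ := by
      field_simp; ring
    rw [this]
    have h0 : (((k : ℝ) + 1) * (x + k + 1))⁻¹ ≤ (((k : ℝ) + 1) ^ 2)⁻¹ := by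
      gcongr; nlinarith
    gcongr
    linarith
  have h5 : 1 / ((k : ℝ) + 1) - 1 / (k + 2) ≤ (((k : ℝ) + 1) ^ 2)⁻¹ := by
    have : 1 / ((k : ℝ) + 1) - 1 / (k + 2) = (((k : ℝ) + 1) * (k + 2))⁻¹ := by
      field_simp; ring
    rw [this]
    gcongr; nlinarith
  have h6 : 0 ≤ (((k : ℝ) + 1) ^ 2)⁻¹ := by positivity
  have h7 : 0 ≤ R * (((k : ℝ) + 1) ^ 2)⁻¹ := by
    have : 0 < R := by linarith
    positivity
  rw [Real.norm_eq_abs, abs_le]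
  constructor <;> linarith

lemma sb_sum0 : Summable (fun k => sbG k 1) := by
  have : (fun k => sbG k 1) = fun _ => 0 := by
    ext k; unfold sbG
    rw [show (1 : ℝ) + k + 1 = k + 2 by ring]; ring
  rw [this]; exact summable_zero

lemma sb_sum1 (x : ℝ) (hx : 0 < x) : Summable (fun k => sbG1 k x) :=
  Summable.of_norm_bounded (sb_summable (x + 1 + 1)) (fun k => sb_b1 (x + 1) k x hx (by linarith))

lemma sb_sum2 (x : ℝ) (hx : 0 < x) : Summable (fun k => sbG2 k x) :=
  Summable.of_norm_bounded (sb_summable 1) (fun k => sb_b2 k x hx)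

lemma sb_sumG (x : ℝ) (hx : 0 < x) : Summable (fun k => sbG k x) :=
  summable_of_summable_hasDerivAt_of_isPreconnected (t := Set.Ioo 0 (x + 2)) (y₀ := 1)
    (sb_summable (x + 2 + 1)) isOpen_Ioo isPreconnected_Ioo (fun n y hy => sb_d1 n y hy.1)
    (fun n y hy => sb_b1 _ n y hy.1 hy.2) ⟨by norm_num, by linarith⟩ sb_sum0 ⟨hx, by linarith⟩

lemma sb_D1 (x : ℝ) (hx : 0 < x) :
    HasDerivAt (fun y => ∑' k, sbG k y) (∑' k, sbG1 k x) x :=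
  hasDerivAt_tsum_of_isPreconnected (t := Set.Ioo 0 (x + 2)) (y₀ := 1)
    (sb_summable (x + 2 + 1)) isOpen_Ioo isPreconnected_Ioo (fun n y hy => sb_d1 n y hy.1)
    (fun n y hy => sb_b1 _ n y hy.1 hy.2) ⟨by norm_num, by linarith⟩ sb_sum0 ⟨hx, by linarith⟩

lemma sb_D2 (x : ℝ) (hx : 0 < x) :
    HasDerivAt (fun y => ∑' k, sbG1 k y) (∑' k, sbG2 k x) x :=
  hasDerivAt_tsum_of_isPreconnected (t := Set.Ioi 0) (y₀ := 1)
    (sb_summable 1) isOpen_Ioi isPreconnected_Ioi (fun n y hy => sb_d2 n y hy)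
    (fun n y hy => sb_b2 n y hy) (by simp) (sb_sum1 1 one_pos) hx

lemma sb_partial (x : ℝ) (n : ℕ) :
    ∑ k ∈ Finset.range n, sbG k x =
      Real.BohrMollerup.logGammaSeq x n + x * (Real.log (n + 1) - Real.log n) + Real.log x := by
  unfold Real.BohrMollerup.logGammaSeq
  rw [Finset.sum_range_succ']
  have h : ∑ k ∈ Finset.range n, sbG k x = x * Real.log (n + 1) + Real.log (n.factorial)
      - ∑ k ∈ Finset.range n, Real.log (x + (k + 1 : ℕ)) := by
    induction n with
    | zero => simp
    | succ n ih =>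
      rw [Finset.sum_range_succ, ih, Finset.sum_range_succ, Nat.factorial_succ, Nat.cast_mul,
        Real.log_mul (by positivity) (by positivity)]
      unfold sbG
      push_cast
      rw [show (n : ℝ) + 1 + 1 = n + 2 by ring, show x + ((n : ℝ) + 1) = x + n + 1 by ring]
      ring
  rw [h]
  push_cast
  rw [add_zero]
  ring

lemma sb_logGamma (x : ℝ) (hx : 0 < x) :
    Real.log (Real.Gamma x) = ∑' k, sbG k x - Real.log x := by
  have h1 := (sb_sumG x hx).hasSum.tendsto_sum_nat
  have h2 : Tendsto (fun n : ℕ => ∑ k ∈ Finset.range n, sbG k x) atTop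
      (𝓝 (Real.log (Real.Gamma x) + x * 0 + Real.log x)) := by
    simp_rw [sb_partial]
    exact ((Real.BohrMollerup.tendsto_log_gamma hx).add
      (Real.tendsto_log_nat_add_one_sub_log.const_mul x)).add_const _
  have := tendsto_nhds_unique h1 h2
  linarith

lemma sb_trigamma (x : ℝ) (hx : 0 < x) :
    trigamma x = ∑' k : ℕ, ((x + k) ^ 2)⁻¹ := by
  have e1 : ∀ y : ℝ, 0 < y →
      HasDerivAt (fun y => Real.log (Real.Gamma y)) (∑' k, sbG1 k y - y⁻¹) y := by
    intro y hy
    refine ((sb_D1 y hy).sub (Real.hasDerivAt_log hy.ne')).congr_of_eventuallyEq ?_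
    filter_upwards [lt_mem_nhds hy] with z hz
    exact sb_logGamma z hz
  have e2 : HasDerivAt (deriv (fun y => Real.log (Real.Gamma y)))
      (∑' k, sbG2 k x - (-(x ^ 2)⁻¹)) x := by
    refine ((sb_D2 x hx).sub (hasDerivAt_inv hx.ne')).congr_of_eventuallyEq ?_
    filter_upwards [lt_mem_nhds hx] with z hz
    exact (e1 z hz).deriv
  unfold trigamma
  rw [iteratedDeriv_succ, iteratedDeriv_one, e2.deriv]
  have hs : Summable (fun k : ℕ => ((x + k) ^ 2)⁻¹) := by
    refine (summable_nat_add_iff 1).1 ?_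
    refine (sb_sum2 x hx).congr ?_
    intro k; simp [sbG2, add_assoc]
  rw [hs.tsum_eq_zero_add]
  simp [sbG2, add_assoc]
  ring

lemma sb_trigamma_summable (x : ℝ) (hx : 0 < x) : Summable (fun k : ℕ => ((x + k) ^ 2)⁻¹) := by
  refine (summable_nat_add_iff 1).1 ?_
  refine (sb_sum2 x hx).congr ?_
  intro k; simp [sbG2, add_assoc]

lemma sb_trigamma_rec (x : ℝ) (hx : 0 < x) :
    trigamma x = (x ^ 2)⁻¹ + trigamma (x + 1) := by
  rw [sb_trigamma x hx, sb_trigamma (x + 1) (by linarith),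
    (sb_trigamma_summable x hx).tsum_eq_zero_add]
  simp only [Nat.cast_zero, add_zero, add_right_inj]
  congr 1
  ext k
  push_cast
  ring

lemma sb_trigamma_lim (x : ℝ) (hx : 0 < x) :
    Tendsto (fun n : ℕ => trigamma (x + n)) atTop (𝓝 0) := by
  refine (tendsto_sum_nat_add (fun k : ℕ => ((x + k) ^ 2)⁻¹)).congr ?_
  intro n
  rw [sb_trigamma (x + n) (by positivity)]
  congr 1
  ext k
  push_cast
  ring

noncomputable def sbA (y : ℝ) : ℝ :=
  Real.log (Real.Gamma (y + 1)) - y * Real.log y + y - 1 / 2 * Real.log (2 * Real.pi * y)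

lemma sb_Gamma_nat (x : ℝ) (hx : 0 < x) (n : ℕ) :
    Real.log (Real.Gamma (x + n + 1)) =
      Real.log (Real.Gamma x) + ∑ m ∈ Finset.range (n + 1), Real.log (x + m) := by
  induction n with
  | zero =>
    simp
    rw [Real.Gamma_add_one hx.ne', Real.log_mul hx.ne' (Real.Gamma_pos_of_pos hx).ne']
    ring
  | succ n ih =>
    have hp : 0 < x + n + 1 := by positivity
    rw [Finset.sum_range_succ, ← add_assoc, ← ih]
    push_cast
    rw [← add_assoc, Real.Gamma_add_one hp.ne',
      Real.log_mul hp.ne' (Real.Gamma_pos_of_pos hp).ne']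
    ring

lemma sb_A_lim (x : ℝ) (hx : 0 < x) :
    Tendsto (fun n : ℕ => sbA (x + n)) atTop (𝓝 0) := by
  have h1 := (Real.BohrMollerup.tendsto_log_gamma hx).const_sub (Real.log (Real.Gamma x))
  have hpi : √π ≠ 0 := by positivity
  have h2 := (Stirling.tendsto_stirlingSeq_sqrt_pi.log hpi).sub_const (Real.log √π)
  have h3 := ((Real.tendsto_log_comp_add_sub_log x).comp tendsto_natCast_atTop_atTop).const_mul
    (x + 1 / 2)
  have h4 := ((Real.tendsto_mul_log_one_add_div_atTop x).comp
    tendsto_natCast_atTop_atTop).const_sub x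
  have h := ((h1.add h2).sub h3).add h4
  simp only [sub_self, mul_zero, add_zero] at h
  refine h.congr' ?_
  filter_upwards [eventually_ge_atTop 1] with n hn
  have hn0 : (0 : ℝ) < n := by exact_mod_cast hn
  have hxn : 0 < x + n := by positivity
  unfold sbA
  rw [sb_Gamma_nat x hx, Stirling.log_stirlingSeq_formula]
  unfold Real.BohrMollerup.logGammaSeq
  simp only [Function.comp]
  have e : (1 : ℝ) + x / n = (x + n) / n := by field_simp; ring
  rw [e, Real.log_div hxn.ne' hn0.ne', Real.log_div hn0.ne' (Real.exp_pos 1).ne', Real.log_exp,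
    Real.log_sqrt Real.pi_pos.le, Real.log_mul two_ne_zero hn0.ne',
    Real.log_mul (by positivity) hxn.ne', Real.log_mul two_ne_zero Real.pi_pos.ne',
    add_comm (n : ℝ) x]
  ring

lemma sb_step (x : ℝ) (hx : 0 < x) :
    sbA (x + 1) - trigamma (x + 1 + 1 / 2) / 12 < sbA x - trigamma (x + 1 / 2) / 12 := by
  have hr := sb_trigamma_rec (x + 1 / 2) (by linarith)
  rw [show x + 1 / 2 + 1 = x + 1 + 1 / 2 by ring] at hr
  have hs := Real.hasSum_log_one_add_inv hx
  have hb := hs.summable.sum_le_tsum (Finset.range 3) (fun i _ => by positivity)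
  rw [hs.tsum_eq, show 1 + x⁻¹ = (x + 1) / x by field_simp,
    Real.log_div (by positivity) hx.ne'] at hb
  simp only [Finset.sum_range_succ, Finset.sum_range_zero] at hb
  have hx1 : 0 < x + 1 := by linarith
  unfold sbA
  rw [Real.Gamma_add_one hx1.ne', Real.log_mul hx1.ne' (Real.Gamma_pos_of_pos hx1).ne', hr,
    Real.log_mul (by positivity) hx.ne', Real.log_mul (by positivity) hx1.ne']
  rw [one_div (2 * x + 1)] at hb
  set t := (2 * x + 1)⁻¹ with ht
  have htp : 0 < t := by positivity
  have hxt : (x + 1 / 2) * t = 1 / 2 := by rw [ht]; field_simp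
  have h2 : ((x + 1 / 2) ^ 2)⁻¹ = 4 * t ^ 2 := by rw [ht]; field_simp; ring
  rw [h2]
  have key : 1 + t ^ 2 / 3 < (x + 1 / 2) * (Real.log (x + 1) - Real.log x) := by
    refine lt_of_lt_of_le ?_ (mul_le_mul_of_nonneg_left hb (by linarith))
    have : 0 < t ^ 4 := by positivity
    have e : (x + 1 / 2) * (2 * t + 2 / 3 * t ^ 3 + 2 / 5 * t ^ 5) =
        1 + t ^ 2 / 3 + t ^ 4 / 5 := by
      linear_combination (2 + 2 / 3 * t ^ 2 + 2 / 5 * t ^ 4) * hxt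
    norm_num at e ⊢
    linarith
  nlinarith

theorem stmt18 (x : ℝ) (hx : 1/2 < x) :
    x ^ x / Real.exp x * Real.sqrt (2 * Real.pi * x) * Real.exp (trigamma (x + 1/2) / 12) <
      Real.Gamma (x + 1) := by
  have hx0 : 0 < x := by linarith
  have hlim : Tendsto (fun n : ℕ => sbA (x + n) - trigamma (x + n + 1 / 2) / 12) atTop (𝓝 0) := by
    have h := (sb_A_lim x hx0).sub
      ((sb_trigamma_lim (x + 1 / 2) (by linarith)).div_const 12)
    simp only [zero_div, sub_zero] at h
    refine h.congr (fun n => ?_)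
    rw [show x + 1 / 2 + (n : ℝ) = x + n + 1 / 2 by ring]
  have hanti : StrictAnti (fun n : ℕ => sbA (x + n) - trigamma (x + n + 1 / 2) / 12) := by
    refine strictAnti_nat_of_succ_lt (fun n => ?_)
    have := sb_step (x + n) (by positivity)
    push_cast
    rwa [← add_assoc]
  have h1 := hanti.antitone.le_of_tendsto hlim 1
  have h0 := hanti (Nat.zero_lt_one)
  have hpos := lt_of_le_of_lt h1 h0
  simp only [Nat.cast_zero, add_zero] at hpos
  unfold sbA at hpos
  rw [← Real.log_lt_log_iff (by positivity) (Real.Gamma_pos_of_pos (by linarith)),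
    Real.log_mul (by positivity) (by positivity), Real.log_mul (by positivity) (by positivity),
    Real.log_div (by positivity) (by positivity), Real.log_exp, Real.log_exp,
    Real.log_rpow hx0, Real.log_sqrt (by positivity)]
  linarith
end
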